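/- Define the fluid success probability P_s = P(E_μ > E_ν · max{1, u*/M}) where u* is the unique nonnegative fixed point of u = A·E[min{E_μ, E_ν max{1,u/M}}] with A = λ(1−P_K) > 0. Then P_s = ν/(μ+ν) if u* ≤ M, and P_s = νM/A if u* > M. -/

import Mathlib

open MeasureTheory ProbabilityTheory

lemma expMeasure_Ioi_aux {r : ℝ} (hr : 0 < r) {x : ℝ} (hx : 0 ≤ x) :
    expMeasure r (Set.Ioi x) = ENNReal.ofReal (Real.exp (-(r * x))) := by
  haveI := isProbabilityMeasure_expMeasure hr
  have h := cdf_expMeasure_eq hr x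
  rw [if_pos hx, cdf_eq_real] at h
  rw [← Set.compl_Iic, ← ofReal_measureReal, measureReal_compl measurableSet_Iic, h]
  simp

lemma expMeasure_Iio_aux {r : ℝ} (hr : 0 < r) : expMeasure r (Set.Iio 0) = 0 := by
  unfold expMeasure gammaMeasure
  rw [withDensity_apply _ measurableSet_Iio]
  exact lintegral_exponentialPDF_of_nonpos le_rfl

lemma ae_nonneg_aux {Ω : Type*} [MeasurableSpace Ω] (P : Measure Ω)
    (X : Ω → ℝ) (r : ℝ) (hr : 0 < r) (hXm : AEMeasurable X P)
    (hX : Measure.map X P = expMeasure r) : ∀ᵐ ω ∂P, 0 ≤ X ω := by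
  have h : ∀ᵐ x ∂(Measure.map X P), 0 ≤ x := by
    rw [hX, ae_iff]
    simp only [not_le]
    exact expMeasure_Iio_aux hr
  exact ae_of_ae_map hXm h

lemma prob_aux {Ω : Type*} [MeasurableSpace Ω] (P : Measure Ω) [IsProbabilityMeasure P]
    (X Y : Ω → ℝ) (μ ν c : ℝ) (hμ : 0 < μ) (hν : 0 < ν) (hc : 0 < c)
    (hXm : AEMeasurable X P) (hYm : AEMeasurable Y P)
    (hX : Measure.map X P = expMeasure μ) (hY : Measure.map Y P = expMeasure ν)
    (hXY : IndepFun X Y P) :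
    (P {ω | X ω > Y ω * c}).toReal = ν / (ν + μ * c) := by
  haveI := isProbabilityMeasure_expMeasure hμ
  haveI := isProbabilityMeasure_expMeasure hν
  have hmap := (indepFun_iff_map_prod_eq_prod_map_map hXm hYm).1 hXY
  have hS : MeasurableSet {p : ℝ × ℝ | p.2 * c < p.1} :=
    measurableSet_lt (by fun_prop) (by fun_prop)
  have h1 : P {ω | X ω > Y ω * c} =
      Measure.map (fun ω => (X ω, Y ω)) P {p : ℝ × ℝ | p.2 * c < p.1} := by
    rw [Measure.map_apply_of_aemeasurable (hXm.prodMk hYm) hS]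
    rfl
  have hr : 0 < ν + μ * c := by positivity
  rw [h1, hmap, hX, hY, Measure.prod_apply_symm hS]
  have h2 : ∫⁻ y, expMeasure μ ((fun x => (x, y)) ⁻¹' {p : ℝ × ℝ | p.2 * c < p.1}) ∂(expMeasure ν)
      = ∫⁻ y, exponentialPDF ν y * expMeasure μ (Set.Ioi (y * c)) := by
    have hm := measurable_measure_prodMk_right (μ := expMeasure μ) hS
    conv_lhs => enter [1]; unfold expMeasure gammaMeasure
    rw [lintegral_withDensity_eq_lintegral_mul _ (by unfold gammaPDF; fun_prop) hm]
    rfl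
  have h3 : ∀ y, exponentialPDF ν y * expMeasure μ (Set.Ioi (y * c)) =
      ENNReal.ofReal (ν / (ν + μ * c)) * exponentialPDF (ν + μ * c) y := by
    intro y
    rcases lt_or_ge y 0 with hy | hy
    · simp [exponentialPDF_of_neg hy]
    · rw [exponentialPDF_of_nonneg hy, exponentialPDF_of_nonneg hy,
        expMeasure_Ioi_aux hμ (by positivity), ← ENNReal.ofReal_mul (by positivity),
        ← ENNReal.ofReal_mul (by positivity)]
      congr 1
      rw [mul_assoc, ← Real.exp_add, ← mul_assoc (ν / (ν + μ * c)), div_mul_cancel₀ _ hr.ne']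
      congr 2
      ring
  rw [h2]
  simp_rw [h3]
  rw [lintegral_const_mul _ (by unfold exponentialPDF; fun_prop), lintegral_exponentialPDF_eq_one hr, mul_one,
    ENNReal.toReal_ofReal (by positivity)]

lemma integral_aux {Ω : Type*} [MeasurableSpace Ω] (P : Measure Ω) [IsProbabilityMeasure P]
    (X Y : Ω → ℝ) (μ ν c : ℝ) (hμ : 0 < μ) (hν : 0 < ν) (hc : 0 < c)
    (hXm : AEMeasurable X P) (hYm : AEMeasurable Y P)
    (hX : Measure.map X P = expMeasure μ) (hY : Measure.map Y P = expMeasure ν)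
    (hXY : IndepFun X Y P) :
    ∫ ω, min (X ω) (Y ω * c) ∂P = c / (ν + μ * c) := by
  have hr : 0 < μ + ν / c := by positivity
  have hZm : AEMeasurable (fun ω => min (X ω) (Y ω * c)) P := hXm.min (hYm.mul_const c)
  have hZ0 : 0 ≤ᵐ[P] fun ω => min (X ω) (Y ω * c) := by
    filter_upwards [ae_nonneg_aux P X μ hμ hXm hX, ae_nonneg_aux P Y ν hν hYm hY] with ω h1 h2
    exact le_min h1 (by positivity)
  rw [integral_eq_lintegral_of_nonneg_ae hZ0 hZm.aestronglyMeasurable,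
    lintegral_eq_lintegral_meas_lt P hZ0 hZm]
  have h1 : ∀ t ∈ Set.Ioi (0 : ℝ), P {ω | t < min (X ω) (Y ω * c)} =
      ENNReal.ofReal (Real.exp (-(μ + ν / c) * t)) := by
    intro t ht
    have ht' : (0 : ℝ) < t := ht
    have : {ω | t < min (X ω) (Y ω * c)} = X ⁻¹' (Set.Ioi t) ∩ Y ⁻¹' (Set.Ioi (t / c)) := by
      ext ω
      simp [lt_min_iff, div_lt_iff₀ hc]
    rw [this, hXY.measure_inter_preimage_eq_mul _ _ measurableSet_Ioi measurableSet_Ioi,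
      ← Measure.map_apply_of_aemeasurable hXm measurableSet_Ioi,
      ← Measure.map_apply_of_aemeasurable hYm measurableSet_Ioi, hX, hY,
      expMeasure_Ioi_aux hμ ht'.le, expMeasure_Ioi_aux hν (by positivity),
      ← ENNReal.ofReal_mul (by positivity), ← Real.exp_add]
    congr 2
    ring
  rw [setLIntegral_congr_fun measurableSet_Ioi h1,
    ← integral_eq_lintegral_of_nonneg_ae (Filter.Eventually.of_forall fun _ => (Real.exp_pos _).le)
      (by fun_prop), integral_exp_mul_Ioi (by linarith)]
  rw [mul_zero, Real.exp_zero, neg_div_neg_eq]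
  have h2 : ν + μ * c ≠ 0 := by positivity
  field_simp
  ring


/-- The fluid success probability: with `X, Y` independent exponentials with rates
`μ, ν` and `u*` the unique nonnegative fixed point of
`u = A · E[min{X, Y·max{1, u/M}}]` (with `A = λ(1−P_K) > 0`), the probability
`P(X > Y·max{1, u*/M})` equals `ν/(μ+ν)` if `u* ≤ M` and `ν·M/A` if `u* > M`. -/
theorem fluid_success_probability
    {Ω : Type*} [MeasurableSpace Ω] (P : Measure Ω) [IsProbabilityMeasure P]
    (X Y : Ω → ℝ) (μ ν M lam PK A ustar : ℝ)
    (hμ : 0 < μ) (hν : 0 < ν) (hM : 0 < M)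
    (hAdef : A = lam * (1 - PK)) (hA : 0 < A)
    (hX : Measure.map X P = expMeasure μ) (hY : Measure.map Y P = expMeasure ν)
    (hXY : IndepFun X Y P)
    (h0 : 0 ≤ ustar)
    (hfix : ustar = A * ∫ ω, min (X ω) (Y ω * max 1 (ustar / M)) ∂P) :
    (ustar ≤ M → (P {ω | X ω > Y ω * max 1 (ustar / M)}).toReal = ν / (μ + ν)) ∧
      (M < ustar → (P {ω | X ω > Y ω * max 1 (ustar / M)}).toReal = ν * M / A) := by
  haveI := isProbabilityMeasure_expMeasure hμ
  haveI := isProbabilityMeasure_expMeasure hν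
  have hXm : AEMeasurable X P := by
    apply AEMeasurable.of_map_ne_zero
    rw [hX]
    exact IsProbabilityMeasure.ne_zero _
  have hYm : AEMeasurable Y P := by
    apply AEMeasurable.of_map_ne_zero
    rw [hY]
    exact IsProbabilityMeasure.ne_zero _
  have hc : 0 < max 1 (ustar / M) := lt_of_lt_of_le one_pos (le_max_left _ _)
  rw [prob_aux P X Y μ ν _ hμ hν hc hXm hYm hX hY hXY]
  rw [integral_aux P X Y μ ν _ hμ hν hc hXm hYm hX hY hXY] at hfix
  constructor
  · intro h
    rw [max_eq_left ((div_le_one hM).2 h), mul_one, add_comm]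
  · intro h
    have hu : 0 < ustar := hM.trans h
    rw [max_eq_right ((one_le_div hM).2 h.le)] at hfix ⊢
    have hd : 0 < ν + μ * (ustar / M) := by positivity
    generalize hD : ν + μ * (ustar / M) = D at *
    field_simp at hfix
    field_simp
    linarith
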